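/- arXiv:1006.3013 — 2 statements merged into one kernel-verified Lean document; each statement's English description precedes it below -/
import Mathlib

section
/- Let L(n, j) denote the number of matchings on [2n] with exactly j left-nestings. Then L(1,0) = 1, and for all n ≥ 2: L(n, 0) = n · L(n-1, 0), and for all j ≥ 1, L(n, j) = (n+j) · L(n-1, j) + (n-j) · L(n-1, j-1). -/
/-- A matching on `[2n] = {1, …, 2n}`: a finite set of pairs `(a, b)` with `a < b`,
whose endpoints are exactly `{1, …, 2n}`, with all endpoints pairwise distinct. -/
def IsMatching (n : ℕ) (X : Finset (ℕ × ℕ)) : Prop :=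
  (∀ p ∈ X, p.1 < p.2) ∧
  (∀ i : ℕ, (1 ≤ i ∧ i ≤ 2 * n) ↔ ∃ p ∈ X, i = p.1 ∨ i = p.2) ∧
  (∀ p ∈ X, ∀ q ∈ X, p ≠ q → p.1 ≠ q.1 ∧ p.1 ≠ q.2 ∧ p.2 ≠ q.1 ∧ p.2 ≠ q.2)

/-- The number of left-nestings of `X`: pairs of pairs `(a,b), (c,d) ∈ X` with
`a < c < d < b` and `c = a + 1`. -/
def numLeftNestings (X : Finset (ℕ × ℕ)) : ℕ :=
  ((X ×ˢ X).filter fun pq => pq.2.1 = pq.1.1 + 1 ∧ pq.2.1 < pq.2.2 ∧ pq.2.2 < pq.1.2).card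

/-- `L n j`: the number of matchings on `[2n]` with exactly `j` left-nestings. -/
noncomputable def L (n j : ℕ) : ℕ :=
  {X : Finset (ℕ × ℕ) | IsMatching n X ∧ numLeftNestings X = j}.ncard

/-- The order embedding of `ℕ` into itself that skips the value `a`. -/
def skip (a x : ℕ) : ℕ := if x < a then x else x + 1

/-- The left inverse of `skip a`. -/
def unskip (a x : ℕ) : ℕ := if x < a then x else x - 1

/-- Insert a new pair `(a, N)` into `Y`, shifting the points `≥ a` of `Y` by one. -/
def insertPair (N a : ℕ) (Y : Finset (ℕ × ℕ)) : Finset (ℕ × ℕ) :=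
  insert (a, N) (Y.image fun p => (skip a p.1, skip a p.2))

/-- The openers of the inner pairs of the left-nestings of `X`. -/
def innerOpeners (X : Finset (ℕ × ℕ)) : Finset ℕ :=
  ((X ×ˢ X).filter fun pq =>
    pq.2.1 = pq.1.1 + 1 ∧ pq.2.1 < pq.2.2 ∧ pq.2.2 < pq.1.2).image fun pq => pq.2.1

/-- The openers of `X` that are not the inner opener of a left-nesting. -/
def freeOpeners (X : Finset (ℕ × ℕ)) : Finset ℕ :=
  X.image Prod.fst \ innerOpeners X

lemma skip_injective (a : ℕ) : Function.Injective (skip a) := by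
  intro x y h
  unfold skip at h
  split_ifs at h <;> omega

lemma skip_unskip {a x : ℕ} (h : x ≠ a) : skip a (unskip a x) = x := by
  unfold skip unskip
  split_ifs <;> omega

lemma mem_insertPair {N a : ℕ} {Y : Finset (ℕ × ℕ)} {x y : ℕ} :
    (x, y) ∈ insertPair N a Y ↔
      (x = a ∧ y = N) ∨ ∃ c d, (c, d) ∈ Y ∧ skip a c = x ∧ skip a d = y := by
  simp [insertPair]

lemma mem_innerOpeners {X : Finset (ℕ × ℕ)} {c : ℕ} :
    c ∈ innerOpeners X ↔
      ∃ a b d, (a, b) ∈ X ∧ (c, d) ∈ X ∧ c = a + 1 ∧ c < d ∧ d < b := by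
  simp only [innerOpeners, Finset.mem_image, Finset.mem_filter, Finset.mem_product, Prod.exists]
  constructor
  · rintro ⟨a, b, c', d, ⟨⟨h1, h2⟩, h3, h4, h5⟩, rfl⟩
    exact ⟨a, b, d, h1, h2, h3, h4, h5⟩
  · rintro ⟨a, b, d, h1, h2, h3, h4, h5⟩
    exact ⟨a, b, c, d, ⟨⟨h1, h2⟩, h3, h4, h5⟩, rfl⟩

lemma innerOpeners_subset (X : Finset (ℕ × ℕ)) : innerOpeners X ⊆ X.image Prod.fst := by
  intro c hc
  obtain ⟨a, b, d, -, h, -⟩ := mem_innerOpeners.1 hc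
  exact Finset.mem_image.2 ⟨_, h, rfl⟩

namespace IsMatching

variable {n : ℕ} {X : Finset (ℕ × ℕ)}

lemma lt (h : IsMatching n X) {a b : ℕ} (hp : (a, b) ∈ X) : a < b := h.1 _ hp

lemma bounds (h : IsMatching n X) {a b : ℕ} (hp : (a, b) ∈ X) : 1 ≤ a ∧ b ≤ 2 * n :=
  ⟨((h.2.1 a).2 ⟨_, hp, Or.inl rfl⟩).1, ((h.2.1 b).2 ⟨_, hp, Or.inr rfl⟩).2⟩

lemma disjoint (h : IsMatching n X) {a b c d : ℕ} (hp : (a, b) ∈ X) (hq : (c, d) ∈ X) :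
    (a = c ∧ b = d) ∨ (a ≠ c ∧ a ≠ d ∧ b ≠ c ∧ b ≠ d) := by
  by_cases e : (a, b) = (c, d)
  · exact Or.inl (Prod.mk.inj e)
  · exact Or.inr (h.2.2 _ hp _ hq e)

lemma injOn_fst (h : IsMatching n X) : Set.InjOn Prod.fst (X : Set (ℕ × ℕ)) := by
  rintro ⟨a, b⟩ hp ⟨c, d⟩ hq e
  have := h.disjoint hp hq
  simp at e ⊢
  omega

lemma card_eq (h : IsMatching n X) : X.card = n := by
  have e : Finset.Icc 1 (2 * n) = X.biUnion fun p => {p.1, p.2} := by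
    ext i
    simpa using h.2.1 i
  have hc := congrArg Finset.card e
  rw [Finset.card_biUnion, Finset.sum_congr rfl (fun p hp => Finset.card_pair (h.1 p hp).ne)] at hc
  · simp at hc
    omega
  · intro p hp q hq hpq
    have := h.2.2 p hp q hq hpq
    rw [Function.onFun, Finset.disjoint_left]
    simp
    omega

lemma card_innerOpeners (h : IsMatching n X) : (innerOpeners X).card = numLeftNestings X := by
  apply Finset.card_image_of_injOn
  rintro ⟨⟨a, b⟩, c, d⟩ hp ⟨⟨a', b'⟩, c', d'⟩ hq e
  simp only [Finset.coe_filter, Finset.mem_product, Set.mem_ofPred_eq] at hp hq e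
  have h1 := h.disjoint hp.1.1 hq.1.1
  have h2 := h.disjoint hp.1.2 hq.1.2
  simp only [Prod.mk.injEq]
  omega

lemma card_freeOpeners (h : IsMatching n X) :
    (freeOpeners X).card + numLeftNestings X = n := by
  rw [freeOpeners, ← h.card_innerOpeners, Finset.card_sdiff_add_card_eq_card
    (innerOpeners_subset X), Finset.card_image_of_injOn h.injOn_fst, h.card_eq]

lemma insertPair {a : ℕ} (h : IsMatching n X) (ha : 1 ≤ a) (ha' : a ≤ 2 * n + 1) :
    IsMatching (n + 1) (insertPair (2 * n + 2) a X) := by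
  refine ⟨?_, ?_, ?_⟩
  · rintro ⟨x, y⟩ hp
    rcases mem_insertPair.1 hp with ⟨rfl, rfl⟩ | ⟨c, d, hcd, rfl, rfl⟩
    · simp; omega
    · have := h.lt hcd
      simp only [skip]
      split_ifs <;> omega
  · intro i
    constructor
    · intro hi
      by_cases h1 : i = a
      · exact ⟨(a, 2 * n + 2), by simp [_root_.insertPair], Or.inl h1⟩
      by_cases h2 : i = 2 * n + 2
      · exact ⟨(a, 2 * n + 2), by simp [_root_.insertPair], Or.inr h2⟩
      obtain ⟨⟨c, d⟩, hcd, e⟩ := (h.2.1 (unskip a i)).1 (by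
        unfold unskip
        split_ifs <;> omega)
      refine ⟨(skip a c, skip a d), mem_insertPair.2 (Or.inr ⟨c, d, hcd, rfl, rfl⟩), ?_⟩
      rw [← skip_unskip h1]
      exact e.imp (congrArg _) (congrArg _)
    · rintro ⟨⟨x, y⟩, hp, e⟩
      rcases mem_insertPair.1 hp with ⟨rfl, rfl⟩ | ⟨c, d, hcd, rfl, rfl⟩
      · simp at e; omega
      · have := h.lt hcd
        have := h.bounds hcd
        simp only [skip] at e
        split_ifs at e <;> omega
  · rintro ⟨x, y⟩ hp ⟨z, w⟩ hq e
    rw [Ne, Prod.mk.injEq] at e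
    rcases mem_insertPair.1 hp with ⟨rfl, rfl⟩ | ⟨c, d, hcd, rfl, rfl⟩ <;>
    rcases mem_insertPair.1 hq with ⟨rfl, rfl⟩ | ⟨c', d', hcd', rfl, rfl⟩
    · simp at e
    · have := h.lt hcd'
      have := h.bounds hcd'
      simp only [skip]
      split_ifs <;> omega
    · have := h.lt hcd
      have := h.bounds hcd
      simp only [skip]
      split_ifs <;> omega
    · have := h.disjoint hcd hcd'
      simp only [(skip_injective a).eq_iff, (skip_injective a).ne_iff] at e ⊢
      omega

lemma exists_eq_insertPair (h : IsMatching (n + 1) X) :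
    ∃ a Y, 1 ≤ a ∧ a ≤ 2 * n + 1 ∧ IsMatching n Y ∧ X = _root_.insertPair (2 * n + 2) a Y := by
  obtain ⟨a, ha⟩ : ∃ a, (a, 2 * n + 2) ∈ X := by
    obtain ⟨⟨c, d⟩, hcd, e⟩ := (h.2.1 (2 * n + 2)).1 (by omega)
    have := h.lt hcd
    have := h.bounds hcd
    simp only at e
    obtain rfl : d = 2 * n + 2 := by omega
    exact ⟨c, hcd⟩
  have ha1 := h.bounds ha
  have ha2 := h.lt ha
  have key : ∀ c d, (c, d) ∈ X.erase (a, 2 * n + 2) →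
      (c, d) ∈ X ∧ c ≠ a ∧ d ≠ a ∧ 1 ≤ c ∧ c < d ∧ d ≤ 2 * n + 1 := by
    intro c d hcd
    rw [Finset.mem_erase, Ne, Prod.mk.injEq] at hcd
    have := h.disjoint hcd.2 ha
    have := h.lt hcd.2
    have := h.bounds hcd.2
    refine ⟨hcd.2, ?_⟩
    omega
  refine ⟨a, (X.erase (a, 2 * n + 2)).image fun p => (unskip a p.1, unskip a p.2),
    by omega, by omega, ⟨?_, ?_, ?_⟩, ?_⟩
  · intro p hp
    obtain ⟨⟨c, d⟩, hcd, rfl⟩ := Finset.mem_image.1 hp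
    have := key c d hcd
    simp only [unskip]
    split_ifs <;> omega
  · intro i
    constructor
    · intro hi
      obtain ⟨⟨c, d⟩, hcd, e⟩ := (h.2.1 (skip a i)).1 (by
        unfold skip
        split_ifs <;> omega)
      have hne : (c, d) ≠ (a, 2 * n + 2) := by
        rintro ⟨⟩
        simp only [skip] at e
        split_ifs at e <;> omega
      refine ⟨_, Finset.mem_image.2 ⟨_, Finset.mem_erase.2 ⟨hne, hcd⟩, rfl⟩, ?_⟩
      simp only [skip, unskip] at e ⊢
      split_ifs at e ⊢ <;> omega
    · rintro ⟨p, hp, e⟩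
      obtain ⟨⟨c, d⟩, hcd, rfl⟩ := Finset.mem_image.1 hp
      have := key c d hcd
      simp only [unskip] at e
      split_ifs at e <;> omega
  · intro p hp q hq e
    obtain ⟨⟨c, d⟩, hcd, rfl⟩ := Finset.mem_image.1 hp
    obtain ⟨⟨c', d'⟩, hcd', rfl⟩ := Finset.mem_image.1 hq
    have h1 := key c d hcd
    have h2 := key c' d' hcd'
    have h3 := h.disjoint h1.1 h2.1
    have h4 : ¬(c = c' ∧ d = d') := by
      rintro ⟨rfl, rfl⟩
      exact e rfl
    simp only [unskip]
    split_ifs <;> omega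
  · rw [_root_.insertPair, Finset.image_image, Finset.image_congr (g := id), Finset.image_id,
      Finset.insert_erase ha]
    rintro ⟨c, d⟩ hcd
    have := key c d hcd
    simp [skip_unskip this.2.1, skip_unskip this.2.2.1]

lemma notMem_image_skip {a b : ℕ} (h : IsMatching n X) :
    (b, 2 * n + 2) ∉ X.image fun p => (skip a p.1, skip a p.2) := by
  intro hb
  obtain ⟨⟨c, d⟩, hcd, e⟩ := Finset.mem_image.1 hb
  have := h.bounds hcd
  simp only [Prod.mk.injEq, skip] at e
  split_ifs at e <;> omega

lemma insertPair_inj {a b : ℕ} {Y : Finset (ℕ × ℕ)} (hX : IsMatching n X) (hY : IsMatching n Y)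
    (e : _root_.insertPair (2 * n + 2) a X = _root_.insertPair (2 * n + 2) b Y) :
    a = b ∧ X = Y := by
  have hab : a = b := by
    have h1 : (a, 2 * n + 2) ∈ _root_.insertPair (2 * n + 2) b Y := by
      rw [← e]
      exact Finset.mem_insert_self _ _
    rcases Finset.mem_insert.1 h1 with h2 | h2
    · exact (Prod.mk.inj h2).1
    · exact absurd h2 hY.notMem_image_skip
  subst hab
  refine ⟨rfl, ?_⟩
  have e' := congrArg (fun Z => Z.erase (a, 2 * n + 2)) e
  simp only [_root_.insertPair, Finset.erase_insert hX.notMem_image_skip,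
    Finset.erase_insert hY.notMem_image_skip] at e'
  refine Finset.image_injective ?_ e'
  exact (skip_injective a).prodMap (skip_injective a)

lemma innerOpeners_insertPair {a : ℕ} (h : IsMatching n X) :
    innerOpeners (_root_.insertPair (2 * n + 2) a X) =
      (innerOpeners X ∪ (freeOpeners X ∩ {a})).image (skip a) := by
  have hU : innerOpeners X ∪ (freeOpeners X ∩ {a}) =
      innerOpeners X ∪ (X.image Prod.fst ∩ {a}) := by
    ext c
    simp only [freeOpeners, Finset.mem_union, Finset.mem_inter, Finset.mem_sdiff]
    tauto
  rw [hU]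
  ext c
  simp only [Finset.mem_image, Finset.mem_union, Finset.mem_inter, Finset.mem_singleton,
    mem_innerOpeners, Prod.exists, exists_and_right, exists_eq_right]
  constructor
  · rintro ⟨x, y, d, h1, h2, h3, h4, h5⟩
    rcases mem_insertPair.1 h2 with ⟨rfl, rfl⟩ | ⟨c', d', hcd, rfl, rfl⟩
    · rcases mem_insertPair.1 h1 with ⟨rfl, rfl⟩ | ⟨x', y', hxy, rfl, rfl⟩
      · omega
      · have := h.bounds hxy
        simp only [skip] at h5
        split_ifs at h5 <;> omega
    · refine ⟨c', ?_, rfl⟩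
      rcases mem_insertPair.1 h1 with ⟨rfl, rfl⟩ | ⟨x', y', hxy, rfl, rfl⟩
      · refine Or.inr ⟨⟨d', hcd⟩, ?_⟩
        simp only [skip] at h3
        split_ifs at h3 <;> omega
      · refine Or.inl ⟨x', y', d', hxy, hcd, ?_⟩
        simp only [skip] at h3 h4 h5
        split_ifs at h3 h4 h5 <;> omega
  · rintro ⟨c, ⟨x, y, d, h1, h2, h3, h4, h5⟩ | ⟨⟨d, hd⟩, rfl⟩, rfl⟩
    · by_cases hc : c = a
      · subst hc
        refine ⟨c, 2 * n + 2, skip c d, mem_insertPair.2 (Or.inl ⟨rfl, rfl⟩),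
          mem_insertPair.2 (Or.inr ⟨c, d, h2, rfl, rfl⟩), ?_⟩
        have := h.bounds h2
        simp only [skip]
        split_ifs <;> omega
      · refine ⟨skip a x, skip a y, skip a d, mem_insertPair.2 (Or.inr ⟨x, y, h1, rfl, rfl⟩),
          mem_insertPair.2 (Or.inr ⟨c, d, h2, rfl, rfl⟩), ?_⟩
        simp only [skip]
        split_ifs <;> omega
    · refine ⟨c, 2 * n + 2, skip c d, mem_insertPair.2 (Or.inl ⟨rfl, rfl⟩),
        mem_insertPair.2 (Or.inr ⟨c, d, hd, rfl, rfl⟩), ?_⟩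
      have := h.bounds hd
      have := h.lt hd
      simp only [skip]
      split_ifs <;> omega

lemma numLeftNestings_insertPair {a : ℕ} (h : IsMatching n X) (ha : 1 ≤ a)
    (ha' : a ≤ 2 * n + 1) :
    numLeftNestings (_root_.insertPair (2 * n + 2) a X) =
      numLeftNestings X + if a ∈ freeOpeners X then 1 else 0 := by
  rw [← (h.insertPair ha ha').card_innerOpeners, h.innerOpeners_insertPair,
    Finset.card_image_of_injective _ (skip_injective a), Finset.card_union_of_disjoint,
    h.card_innerOpeners]
  · split_ifs with hf
    · rw [Finset.inter_singleton_of_mem hf, Finset.card_singleton]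
    · rw [Finset.inter_singleton_of_notMem hf, Finset.card_empty]
  · exact Finset.disjoint_sdiff.mono_right Finset.inter_subset_left

lemma freeOpeners_subset (h : IsMatching n X) :
    freeOpeners X ⊆ Finset.Icc 1 (2 * n + 1) := by
  intro c hc
  obtain ⟨⟨c, d⟩, hcd, rfl⟩ := Finset.mem_image.1 (Finset.mem_sdiff.1 hc).1
  have := h.bounds hcd
  have := h.lt hcd
  simp only [Finset.mem_Icc]
  omega

/-- The number of ways of inserting a pair ending at the last point so as to obtain `j`
left-nestings. -/
lemma card_insertions (h : IsMatching n X) (j : ℕ) :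
    (((Finset.Icc 1 (2 * n + 1)).filter fun a =>
      numLeftNestings X + (if a ∈ freeOpeners X then 1 else 0) = j).card : ℤ) =
      (if numLeftNestings X = j then (n : ℤ) + 1 + j else 0) +
        if numLeftNestings X + 1 = j then (n : ℤ) + 1 - j else 0 := by
  have hc := h.card_freeOpeners
  have hs := h.freeOpeners_subset
  by_cases h1 : numLeftNestings X = j
  · have e : ((Finset.Icc 1 (2 * n + 1)).filter fun a =>
        numLeftNestings X + (if a ∈ freeOpeners X then 1 else 0) = j) =
        Finset.Icc 1 (2 * n + 1) \ freeOpeners X := by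
      ext a
      simp [h1]
    have := Finset.card_sdiff_add_card_eq_card hs
    rw [e, if_pos h1, if_neg (by omega)]
    simp at this
    omega
  by_cases h2 : numLeftNestings X + 1 = j
  · have e : ((Finset.Icc 1 (2 * n + 1)).filter fun a =>
        numLeftNestings X + (if a ∈ freeOpeners X then 1 else 0) = j) = freeOpeners X := by
      ext a
      rw [Finset.mem_filter]
      by_cases ha : a ∈ freeOpeners X
      · simp only [ha, if_true, h2, hs ha, and_self]
      · simp only [ha, if_false, add_zero, h1, and_false]
    rw [e, if_neg h1, if_pos h2]
    omega
  · rw [if_neg h1, if_neg h2, Finset.filter_false_of_mem]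
    · simp
    · intro a _
      split_ifs <;> omega

end IsMatching

open scoped Classical in
/-- The finite set of all matchings on `[2n]`. -/
noncomputable def matchings (n : ℕ) : Finset (Finset (ℕ × ℕ)) :=
  (Finset.Icc 1 (2 * n) ×ˢ Finset.Icc 1 (2 * n)).powerset.filter (IsMatching n)

open scoped Classical in
lemma mem_matchings {n : ℕ} {X : Finset (ℕ × ℕ)} : X ∈ matchings n ↔ IsMatching n X := by
  rw [matchings, Finset.mem_filter, Finset.mem_powerset, and_iff_right_iff_imp]
  rintro h ⟨a, b⟩ hp
  have := h.bounds hp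
  have := h.lt hp
  simp only [Finset.mem_product, Finset.mem_Icc]
  omega

lemma L_eq_card (n j : ℕ) : L n j = ((matchings n).filter (numLeftNestings · = j)).card := by
  rw [L, ← Set.ncard_coe_finset]
  congr 1
  ext X
  simp [mem_matchings]

lemma L_succ_eq_sum (n j : ℕ) :
    L (n + 1) j = ∑ X ∈ matchings n, ((Finset.Icc 1 (2 * n + 1)).filter fun a =>
      numLeftNestings X + (if a ∈ freeOpeners X then 1 else 0) = j).card := by
  rw [L_eq_card, ← Finset.card_sigma]
  symm
  refine Finset.card_bij (fun p _ => insertPair (2 * n + 2) p.2 p.1) ?_ ?_ ?_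
  · rintro ⟨X, a⟩ hp
    simp only [Finset.mem_sigma, mem_matchings, Finset.mem_filter, Finset.mem_Icc] at hp ⊢
    obtain ⟨h, ⟨ha, ha'⟩, hj⟩ := hp
    exact ⟨h.insertPair ha ha', (h.numLeftNestings_insertPair ha ha').trans hj⟩
  · rintro ⟨X, a⟩ hp ⟨Y, b⟩ hq e
    simp only [Finset.mem_sigma, mem_matchings] at hp hq
    obtain ⟨rfl, rfl⟩ := hp.1.insertPair_inj hq.1 e
    rfl
  · intro Z hZ
    rw [Finset.mem_filter, mem_matchings] at hZ
    obtain ⟨a, X, ha, ha', h, rfl⟩ := hZ.1.exists_eq_insertPair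
    refine ⟨⟨X, a⟩, ?_, rfl⟩
    simp only [Finset.mem_sigma, mem_matchings, Finset.mem_filter, Finset.mem_Icc]
    exact ⟨h, ⟨ha, ha'⟩, (h.numLeftNestings_insertPair ha ha').symm.trans hZ.2⟩

lemma L_succ (n j : ℕ) :
    (L (n + 1) j : ℤ) = ((n : ℤ) + 1 + j) * L n j +
      ((n : ℤ) + 1 - j) * ((matchings n).filter (numLeftNestings · + 1 = j)).card := by
  rw [L_succ_eq_sum, Nat.cast_sum,
    Finset.sum_congr rfl fun X hX => (mem_matchings.1 hX).card_insertions j,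
    Finset.sum_add_distrib, ← Finset.sum_filter, ← Finset.sum_filter, Finset.sum_const,
    Finset.sum_const, L_eq_card]
  simp only [nsmul_eq_mul]
  ring

lemma L_succ_zero (n : ℕ) : L (n + 1) 0 = (n + 1) * L n 0 := by
  have := L_succ n 0
  simp at this
  exact_mod_cast this

lemma L_succ_succ (n j : ℕ) :
    (L (n + 1) (j + 1) : ℤ) = ((n : ℤ) + 1 + (j + 1)) * L n (j + 1) +
      ((n : ℤ) + 1 - (j + 1)) * L n j := by
  have := L_succ n (j + 1)
  simp only [Nat.add_right_cancel_iff, ← L_eq_card] at this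
  exact_mod_cast this

lemma L_zero_zero : L 0 0 = 1 := by
  rw [L, Set.ncard_eq_one]
  refine ⟨∅, Set.ext fun X => ⟨fun h => ?_, ?_⟩⟩
  · exact Finset.card_eq_zero.1 h.1.card_eq
  · rintro rfl
    refine ⟨⟨by simp, fun i => ?_, by simp⟩, rfl⟩
    simp
    omega

/-- `L(1,0) = 1`, and for `n ≥ 2`: `L(n,0) = n·L(n-1,0)` and, for `j ≥ 1`,
`L(n,j) = (n+j)·L(n-1,j) + (n-j)·L(n-1,j-1)`. -/
theorem left_nesting_recurrence :
    L 1 0 = 1 ∧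
    ∀ n : ℕ, 2 ≤ n →
      (L n 0 = n * L (n - 1) 0 ∧
        ∀ j : ℕ, 1 ≤ j →
          (L n j : ℤ) = ((n : ℤ) + j) * L (n - 1) j + ((n : ℤ) - j) * L (n - 1) (j - 1)) := by
  refine ⟨by rw [L_succ_zero 0, L_zero_zero], fun n hn => ?_⟩
  obtain ⟨n, rfl⟩ := Nat.exists_eq_succ_of_ne_zero (by omega : n ≠ 0)
  refine ⟨L_succ_zero n, fun j hj => ?_⟩
  obtain ⟨j, rfl⟩ := Nat.exists_eq_succ_of_ne_zero (by omega : j ≠ 0)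
  simpa using L_succ_succ n j
end

section
/- Let X' be a matching on [2n+2] with no left-nestings containing the pair (a, 2n+2). Then the matching X on [2n] obtained from X' by deleting the pair (a, 2n+2) and relabeling (decreasing every endpoint greater than a by one) has no left-nestings. -/
/-- A left-nesting: pairs `(a, b), (c, d) ∈ X` with `a < c < d < b` and `c = a + 1`. -/
def HasLeftNesting (X : Finset (ℕ × ℕ)) : Prop :=
  ∃ p ∈ X, ∃ q ∈ X, q.1 = p.1 + 1 ∧ q.1 < q.2 ∧ q.2 < p.2

/-- Delete the arc `(a, M)` from `X'` and relabel: decrease every endpoint greater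
than `a` by one. -/
def deleteArc (X' : Finset (ℕ × ℕ)) (a M : ℕ) : Finset (ℕ × ℕ) :=
  (X'.erase (a, M)).image fun p =>
    (if a < p.1 then p.1 - 1 else p.1, if a < p.2 then p.2 - 1 else p.2)

theorem mem_deleteArc {X' : Finset (ℕ × ℕ)} {a M : ℕ} {r : ℕ × ℕ} :
    r ∈ deleteArc X' a M ↔ ∃ p ∈ X', p ≠ (a, M) ∧
      r = (if a < p.1 then p.1 - 1 else p.1, if a < p.2 then p.2 - 1 else p.2) := by
  simp only [deleteArc, Finset.mem_image, Finset.mem_erase]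
  constructor
  · rintro ⟨p, ⟨hne, hp⟩, rfl⟩
    exact ⟨p, hp, hne, rfl⟩
  · rintro ⟨p, hp, hne, rfl⟩
    exact ⟨p, ⟨hne, hp⟩, rfl⟩

/-- The arcs of a matching other than `(a, M)`, where `M` is the last point, have endpoints
in `[1, M)` different from `a`. -/
theorem IsMatching.endpoints_of_ne {n a : ℕ} {X' : Finset (ℕ × ℕ)}
    (hX' : IsMatching (n + 1) X') (ha : (a, 2 * n + 2) ∈ X') {p : ℕ × ℕ} (hp : p ∈ X')
    (hne : p ≠ (a, 2 * n + 2)) :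
    1 ≤ p.1 ∧ p.1 < p.2 ∧ p.2 < 2 * n + 2 ∧ p.1 ≠ a ∧ p.2 ≠ a := by
  obtain ⟨hlt, hcov, hdisj⟩ := hX'
  have h := hdisj p hp _ ha hne
  have h₁ := (hcov p.1).2 ⟨p, hp, Or.inl rfl⟩
  have h₂ := (hcov p.2).2 ⟨p, hp, Or.inr rfl⟩
  have h₃ := hlt p hp
  dsimp only at h
  omega

/-- If `X'` is a matching on `[2n+2]` with no left-nestings containing the pair
`(a, 2n+2)`, then the matching on `[2n]` obtained by deleting `(a, 2n+2)` and
relabeling is a matching on `[2n]` with no left-nestings. -/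
theorem deleteArc_no_left_nesting (n a : ℕ) (X' : Finset (ℕ × ℕ))
    (hX' : IsMatching (n + 1) X') (hno : ¬ HasLeftNesting X')
    (ha : (a, 2 * n + 2) ∈ X') :
    IsMatching n (deleteArc X' a (2 * n + 2)) ∧
      ¬ HasLeftNesting (deleteArc X' a (2 * n + 2)) := by
  have hend : ∀ p ∈ X', p ≠ (a, 2 * n + 2) →
      1 ≤ p.1 ∧ p.1 < p.2 ∧ p.2 < 2 * n + 2 ∧ p.1 ≠ a ∧ p.2 ≠ a :=
    fun p hp hne => hX'.endpoints_of_ne ha hp hne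
  obtain ⟨hlt, hcov, hdisj⟩ := hX'
  have ha_pos : 1 ≤ a := ((hcov a).2 ⟨_, ha, Or.inl rfl⟩).1
  have ha_lt : a < 2 * n + 2 := hlt _ ha
  refine ⟨⟨?_, ?_, ?_⟩, ?_⟩
  · intro r hr
    obtain ⟨p, hp, hne, rfl⟩ := mem_deleteArc.1 hr
    have := hend p hp hne
    dsimp only
    split_ifs <;> omega
  · intro i
    constructor
    · intro hi
      obtain ⟨p, hp, hpi⟩ := (hcov (if i < a then i else i + 1)).1 (by split_ifs <;> omega)
      have hne : p ≠ (a, 2 * n + 2) := by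
        rintro rfl
        dsimp only at hpi
        split_ifs at hpi <;> omega
      refine ⟨_, mem_deleteArc.2 ⟨p, hp, hne, rfl⟩, ?_⟩
      dsimp only
      rcases hpi with h | h
      · left
        split_ifs at h ⊢ <;> omega
      · right
        split_ifs at h ⊢ <;> omega
    · rintro ⟨r, hr, hi⟩
      obtain ⟨p, hp, hne, rfl⟩ := mem_deleteArc.1 hr
      have := hend p hp hne
      dsimp only at hi
      split_ifs at hi <;> omega
  · intro r hr s hs hrs
    obtain ⟨p, hp, hpne, rfl⟩ := mem_deleteArc.1 hr
    obtain ⟨q, hq, hqne, rfl⟩ := mem_deleteArc.1 hs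
    have hpq : p ≠ q := by
      rintro rfl
      exact hrs rfl
    have := hdisj p hp q hq hpq
    have := hend p hp hpne
    have := hend q hq hqne
    clear hrs hr hs
    dsimp only
    refine ⟨?_, ?_, ?_, ?_⟩ <;> split_ifs <;> omega
  · rintro ⟨r, hr, s, hs, h₁, h₂, h₃⟩
    obtain ⟨p, hp, hpne, rfl⟩ := mem_deleteArc.1 hr
    obtain ⟨q, hq, hqne, rfl⟩ := mem_deleteArc.1 hs
    have hp_end := hend p hp hpne
    have hq_end := hend q hq hqne
    dsimp only at h₁ h₂ h₃
    by_cases hq_next : q.1 = a + 1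
    · exact hno ⟨_, ha, q, hq, hq_next, hq_end.2.1, hq_end.2.2.1⟩
    · have hsucc : q.1 = p.1 + 1 := by
        clear h₂ h₃
        split_ifs at h₁ <;> omega
      have hinner : q.2 < p.2 := by
        clear h₁ h₂
        split_ifs at h₃ <;> omega
      exact hno ⟨p, hp, q, hq, hsucc, hq_end.2.1, hinner⟩
end
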